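/- Let n ≥ 2 be an integer, p₀, p ∈ Sⁿ with p ≠ p₀, and a ∈ (0,π). Then (1/|B_a|) · ∫_{q ∈ B(p₀,a)} g_n(‖p − q‖) dσ(q) ≤ g_n(‖p − p₀‖) + K(n,a), with equality if p ∉ B(p₀,a); here |B_a| = V_{n−1}·∫₀^a sin^{n−1}r dr. -/

import Mathlib

open MeasureTheory Real Filter
open scoped RealInnerProductSpace

noncomputable def poch (x : ℝ) (k : ℕ) : ℝ := ∏ i ∈ Finset.range k, (x + i)

noncomputable def incBeta (x α β : ℝ) : ℝ := ∫ t in (0:ℝ)..x, t ^ (α - 1) * (1 - t) ^ (β - 1)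

noncomputable def sphereVol (n : ℕ) : ℝ :=
  2 * Real.pi ^ (((n : ℝ) + 1) / 2) / Real.Gamma (((n : ℝ) + 1) / 2)

noncomputable def green (n : ℕ) (t : ℝ) : ℝ :=
  2 / (n * sphereVol n) * ∑' k : ℕ,
    poch n k / (((k : ℝ) + 1) * poch ((n : ℝ) / 2 + 1) k) *
      ((1 - t ^ 2 / 4) ^ (k + 1)
        - incBeta 1 ((n : ℝ) / 2) ((n : ℝ) / 2 + k + 1) / incBeta 1 ((n : ℝ) / 2) ((n : ℝ) / 2))

noncomputable def Kfun (n : ℕ) (a : ℝ) : ℝ :=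
  2 / (n * sphereVol n) * ∑' k : ℕ,
    poch n k / (poch ((n : ℝ) / 2 + 1) k * ((k : ℝ) + 1)) *
      (incBeta (Real.sin (a / 2) ^ 2) ((n : ℝ) / 2 + k + 1) ((n : ℝ) / 2) /
        incBeta (Real.sin (a / 2) ^ 2) ((n : ℝ) / 2) ((n : ℝ) / 2))

noncomputable def ballVol (n : ℕ) (a : ℝ) : ℝ :=
  sphereVol (n - 1) * ∫ r in (0:ℝ)..a, Real.sin r ^ (n - 1)

noncomputable def sphereMeasure (n : ℕ) :
    Measure (Metric.sphere (0 : EuclideanSpace ℝ (Fin (n + 1))) 1) :=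
  (volume : Measure (EuclideanSpace ℝ (Fin (n + 1)))).toSphere

/-! ### Polar coordinates -/

theorem lintegral_eq_lintegral_toSphere {E : Type*} [NormedAddCommGroup E] [NormedSpace ℝ E]
    [FiniteDimensional ℝ E] [Nontrivial E] [MeasurableSpace E] [BorelSpace E]
    (μ : Measure E) [μ.IsAddHaarMeasure] {g : E → ENNReal} (hg : Measurable g) :
    ∫⁻ x, g x ∂μ = ∫⁻ ω : Metric.sphere (0 : E) 1, (∫⁻ ρ in Set.Ioi (0:ℝ),
      ENNReal.ofReal (ρ ^ (Module.finrank ℝ E - 1)) * g (ρ • (ω : E))) ∂μ.toSphere := by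
  have h1 : ∫⁻ x, g x ∂μ = ∫⁻ x : ({0}ᶜ : Set E), g x ∂(μ.comap (↑)) := by
    rw [lintegral_subtype_comap (measurableSet_singleton _).compl,
      Measure.restrict_eq_self_of_ae_mem]
    exact compl_mem_ae_iff.2 (measure_singleton 0)
  have hmp := μ.measurePreserving_homeomorphUnitSphereProd
  have h2 : ∫⁻ x : ({0}ᶜ : Set E), g x ∂(μ.comap (↑)) =
      ∫⁻ p : Metric.sphere (0 : E) 1 × Set.Ioi (0 : ℝ), g ((p.2 : ℝ) • (p.1 : E))
        ∂(μ.toSphere.prod (Measure.volumeIoiPow (Module.finrank ℝ E - 1))) := by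
    rw [← hmp.lintegral_comp_emb (Homeomorph.measurableEmbedding _)]
    refine lintegral_congr fun x => ?_
    congr 1
    have hx : ‖(x : E)‖ ≠ 0 := norm_ne_zero_iff.2 x.2
    simp [smul_smul, hx]
  rw [h1, h2, lintegral_prod _ (by fun_prop)]
  refine lintegral_congr fun ω => ?_
  rw [Measure.volumeIoiPow, lintegral_withDensity_eq_lintegral_mul _ (by fun_prop) (by fun_prop)]
  simp only [Pi.mul_apply]
  exact lintegral_subtype_comap (μ := volume) measurableSet_Ioi
    (fun ρ : ℝ => ENNReal.ofReal (ρ ^ (Module.finrank ℝ E - 1)) * g (ρ • (ω : E)))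

/-- Geodesic polar coordinates on the unit sphere around the pole `v`. -/
theorem lintegral_toSphere_eq {E F : Type*} [NormedAddCommGroup E] [InnerProductSpace ℝ E]
    [FiniteDimensional ℝ E] [MeasurableSpace E] [BorelSpace E]
    [NormedAddCommGroup F] [InnerProductSpace ℝ F]
    [FiniteDimensional ℝ F] [MeasurableSpace F] [BorelSpace F] {d : ℕ}
    (hF : Module.finrank ℝ F = d + 1) (hE : Module.finrank ℝ E = d + 2)
    (j : F →ₗᵢ[ℝ] E) (v : E) (hv : ‖v‖ = 1) (hj : ∀ w, ⟪v, j w⟫ = 0)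
    {f : E → ENNReal} (hf : Measurable f) :
    ∫⁻ q : Metric.sphere (0 : E) 1, f q ∂(volume : Measure E).toSphere =
      ∫⁻ r in Set.Ioo 0 π, ENNReal.ofReal (sin r ^ d) *
        ∫⁻ ω : Metric.sphere (0 : F) 1, f (cos r • v + sin r • j ω)
          ∂(volume : Measure F).toSphere := by
  have : Nontrivial F := Module.nontrivial_of_finrank_pos (R := ℝ) (by omega)
  have : Nontrivial E := Module.nontrivial_of_finrank_pos (R := ℝ) (by omega)
  have hnorm : ∀ s w, ‖s • v + j w‖ ^ 2 = s ^ 2 + ‖w‖ ^ 2 := fun s w => by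
    rw [norm_add_sq_real, inner_smul_left, hj, norm_smul, hv, j.norm_map]; simp
  let L : WithLp 2 (ℝ × F) →ₗᵢ[ℝ] E :=
    { toFun := fun x => x.fst • v + j x.snd
      map_add' := fun x y => by simp [add_smul]; abel
      map_smul' := fun c x => by simp [mul_smul]
      norm_map' := fun x => by
        rw [← sq_eq_sq₀ (norm_nonneg _) (norm_nonneg _)]
        change ‖x.fst • v + j x.snd‖ ^ 2 = _
        rw [hnorm, WithLp.prod_norm_sq_eq_of_L2]; simp }
  have hfin : Module.finrank ℝ (WithLp 2 (ℝ × F)) = Module.finrank ℝ E := by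
    rw [(WithLp.linearEquiv 2 ℝ (ℝ × F)).finrank_eq, Module.finrank_prod, hF, hE]; simp; omega
  let e := L.toLinearIsometryEquiv hfin
  let A : ENNReal := ∫⁻ ρ in Set.Ioi (0:ℝ), ENNReal.ofReal (ρ ^ (d + 1)) *
    (Set.Iio (1:ℝ)).indicator 1 ρ
  have hA : A ≠ 0 ∧ A ≠ ⊤ := by
    have : A = ENNReal.ofReal (∫ ρ in (0:ℝ)..1, ρ ^ (d + 1)) := by
      have h1 : A = ∫⁻ ρ in Set.Ioo (0:ℝ) 1, ENNReal.ofReal (ρ ^ (d + 1)) := by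
        rw [← Set.Ioi_inter_Iio, Set.inter_comm, ← Measure.restrict_restrict measurableSet_Iio,
          ← lintegral_indicator measurableSet_Iio]
        refine lintegral_congr fun ρ => ?_
        by_cases h : ρ ∈ Set.Iio (1:ℝ) <;> simp [h]
      rw [h1, restrict_Ioo_eq_restrict_Ioc, intervalIntegral.integral_of_le zero_le_one,
        ofReal_integral_eq_lintegral_ofReal (intervalIntegral.intervalIntegrable_pow _).1]
      filter_upwards [ae_restrict_mem measurableSet_Ioc] with y hy
      exact pow_nonneg hy.1.le _
    rw [this]
    refine ⟨?_, ENNReal.ofReal_ne_top⟩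
    rw [integral_pow, Ne, ENNReal.ofReal_eq_zero, not_le]
    simp
    positivity
  let g : E → ENNReal := fun x => (Set.Iio (1:ℝ)).indicator 1 ‖x‖ * f (‖x‖⁻¹ • x)
  have hind : Measurable ((Set.Iio (1:ℝ)).indicator (1 : ℝ → ENNReal)) :=
    measurable_one.indicator measurableSet_Iio
  have hg : Measurable g := by fun_prop
  have hgpol : ∀ ρ > 0, ∀ x : E, ‖x‖ = 1 → g (ρ • x) = (Set.Iio (1:ℝ)).indicator 1 ρ * f x := by
    intro ρ hρ x hx
    simp only [g, norm_smul, hx, mul_one, norm_eq_abs, abs_of_pos hρ, smul_smul]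
    rw [inv_mul_cancel₀ hρ.ne', one_smul]
  have hL : ∫⁻ x, g x = (∫⁻ q : Metric.sphere (0 : E) 1, f q ∂(volume : Measure E).toSphere) * A := by
    rw [lintegral_eq_lintegral_toSphere _ hg, ← lintegral_mul_const _ (by fun_prop)]
    refine lintegral_congr fun ω => ?_
    rw [← lintegral_const_mul _ (by fun_prop)]
    refine setLIntegral_congr_fun measurableSet_Ioi fun ρ hρ => ?_
    rw [hgpol ρ hρ ω (by simp), hE]
    simp only [Nat.add_one_sub_one]
    ring
  have hR : ∫⁻ x, g x = ∫⁻ s : ℝ, ∫⁻ w : F, g (s • v + j w) := by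
    have hmp : MeasurePreserving (fun p : ℝ × F => p.1 • v + j p.2) := 
      (e.measurePreserving).comp (WithLp.volume_preserving_toLp ℝ F)
    have := hmp.lintegral_comp hg
    rw [← this, Measure.volume_eq_prod, lintegral_prod _ (by
      exact (hg.comp hmp.measurable).aemeasurable)]
  have hR2 : ∫⁻ s : ℝ, ∫⁻ w : F, g (s • v + j w) =
      ∫⁻ ω : Metric.sphere (0 : F) 1, (∫⁻ p : ℝ × ℝ, (Set.Ioi (0:ℝ)).indicator
        (fun t => ENNReal.ofReal (t ^ d) * g (p.1 • v + t • j ω)) p.2)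
          ∂(volume : Measure F).toSphere := by
    have hjm : Measurable j := j.continuous.measurable
    have : ∀ s : ℝ, ∫⁻ w : F, g (s • v + j w) = ∫⁻ ω : Metric.sphere (0 : F) 1, (∫⁻ t : ℝ,
        (Set.Ioi (0:ℝ)).indicator
        (fun t => ENNReal.ofReal (t ^ d) * g (s • v + t • j ω)) t)
          ∂(volume : Measure F).toSphere := by
      intro s
      rw [lintegral_eq_lintegral_toSphere _ (by fun_prop)]
      refine lintegral_congr fun ω => ?_
      rw [lintegral_indicator measurableSet_Ioi, hF]
      simp
    simp_rw [this]
    have hm : Measurable (fun x : (Metric.sphere (0 : F) 1) × (ℝ × ℝ) =>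
      (Set.Ioi (0:ℝ)).indicator
        (fun t => ENNReal.ofReal (t ^ d) * g (x.2.1 • v + t • j x.1)) x.2.2) := by
      have : (fun x : (Metric.sphere (0 : F) 1) × (ℝ × ℝ) =>
      (Set.Ioi (0:ℝ)).indicator
        (fun t => ENNReal.ofReal (t ^ d) * g (x.2.1 • v + t • j x.1)) x.2.2) = 
        {x | x.2.2 ∈ Set.Ioi (0:ℝ)}.indicator (fun x => 
          ENNReal.ofReal (x.2.2 ^ d) * g (x.2.1 • v + x.2.2 • j x.1)) := by
        ext x; simp [Set.indicator]
      rw [this]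
      refine Measurable.indicator (by fun_prop) (measurableSet_Ioi.preimage (by fun_prop))
    rw [lintegral_lintegral_swap]
    · refine lintegral_congr fun ω => ?_
      rw [Measure.volume_eq_prod, lintegral_prod]
      exact (hm.comp measurable_prodMk_left).aemeasurable
    · refine Measurable.aemeasurable ?_
      refine Measurable.lintegral_prod_right' (f := fun x : (ℝ × Metric.sphere (0 : F) 1) × ℝ =>
        (Set.Ioi (0:ℝ)).indicator (fun t => ENNReal.ofReal (t ^ d) * g (x.1.1 • v + t • j x.1.2)) x.2) ?_
      exact hm.comp (g := fun x : (Metric.sphere (0 : F) 1) × (ℝ × ℝ) =>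
      (Set.Ioi (0:ℝ)).indicator
        (fun t => ENNReal.ofReal (t ^ d) * g (x.2.1 • v + t • j x.1)) x.2.2) 
        (f := fun x : (ℝ × Metric.sphere (0 : F) 1) × ℝ => (x.1.2, (x.1.1, x.2))) (by fun_prop)
  have hpol : ∀ ω : Metric.sphere (0 : F) 1, ∫⁻ p : ℝ × ℝ, (Set.Ioi (0:ℝ)).indicator
        (fun t => ENNReal.ofReal (t ^ d) * g (p.1 • v + t • j ω)) p.2 =
      A * ∫⁻ r in Set.Ioo 0 π, ENNReal.ofReal (sin r ^ d) * f (cos r • v + sin r • j ω) := by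
    intro ω
    have hjω : ‖j ω‖ = 1 := by simp
    rw [← lintegral_comp_polarCoord_symm, polarCoord_target, Measure.volume_eq_prod,
      ← Measure.prod_restrict, ← lintegral_prod_mul (by fun_prop) (by fun_prop)]
    have hs : (Set.Ioo 0 π) = Set.Ioo 0 π ∩ Set.Ioo (-π) π := by
      rw [Set.left_eq_inter]; exact Set.Ioo_subset_Ioo_left (by linarith [pi_pos])
    have h1 : (volume.restrict (Set.Ioi (0:ℝ))).prod (volume.restrict (Set.Ioo 0 π)) =
        ((volume.restrict (Set.Ioi (0:ℝ))).prod (volume.restrict (Set.Ioo (-π) π))).restrict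
          (Set.univ ×ˢ Set.Ioo 0 π) := by
      rw [← Measure.prod_restrict, Measure.restrict_univ, Measure.restrict_restrict measurableSet_Ioo,
        ← hs]
    rw [h1, ← lintegral_indicator (MeasurableSet.univ.prod measurableSet_Ioo)]
    rw [Measure.prod_restrict]
    refine setLIntegral_congr_fun (measurableSet_Ioi.prod measurableSet_Ioo) fun p hp => ?_
    obtain ⟨hρ : 0 < p.1, hr⟩ := hp
    simp only [polarCoord_symm_apply, smul_eq_mul]
    by_cases h : p.2 ∈ Set.Ioo 0 π
    · have hsin := sin_pos_of_mem_Ioo h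
      rw [Set.indicator_of_mem (by exact mul_pos hρ hsin), Set.indicator_of_mem (by exact ⟨trivial, h⟩),
        mul_smul, mul_smul, ← smul_add, hgpol _ hρ, mul_pow, pow_succ,
        ENNReal.ofReal_mul (by positivity), ENNReal.ofReal_mul (by positivity)]
      · ring
      · rw [← sq_eq_sq₀ (norm_nonneg _) zero_le_one, ← map_smul, hnorm, norm_smul]
        simp
    · rw [Set.indicator_of_notMem (s := Set.univ ×ˢ Set.Ioo 0 π) (by exact fun h' => h h'.2),
        Set.indicator_of_notMem, mul_zero]
      intro h'
      have h' : 0 < p.1 * sin p.2 := h'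
      refine h ⟨?_, hr.2⟩
      by_contra! h0
      nlinarith [sin_nonpos_of_nonpos_of_neg_pi_le h0 hr.1.le]
  have key : (∫⁻ q : Metric.sphere (0 : E) 1, f q ∂(volume : Measure E).toSphere) * A = 
      (∫⁻ r in Set.Ioo 0 π, ENNReal.ofReal (sin r ^ d) *
        ∫⁻ ω : Metric.sphere (0 : F) 1, f (cos r • v + sin r • j ω)
          ∂(volume : Measure F).toSphere) * A := by
    have hjm : Measurable j := j.continuous.measurable
    rw [← hL, hR, hR2]
    simp_rw [hpol]
    rw [lintegral_const_mul _ (by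
      exact Measurable.lintegral_prod_right' (f := fun x : Metric.sphere (0 : F) 1 × ℝ =>
        ENNReal.ofReal (sin x.2 ^ d) * f (cos x.2 • v + sin x.2 • j x.1)) (by fun_prop)), mul_comm]
    congr 1
    rw [lintegral_lintegral_swap (by fun_prop)]
    exact lintegral_congr fun r => lintegral_const_mul _ (by fun_prop)
  exact (ENNReal.mul_left_inj hA.1 hA.2).1 key

/-! ### Power series with polynomially bounded coefficients -/

/-- `|a k|` is at most a polynomial in `k`. -/
def PolyBounded (a : ℕ → ℝ) : Prop := ∃ C : ℝ, ∃ j : ℕ, ∀ k : ℕ, |a k| ≤ C * ((k : ℝ) + 1) ^ j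

theorem PolyBounded.summable {a : ℕ → ℝ} (ha : PolyBounded a) {x : ℝ} (hx : |x| < 1) :
    Summable fun k => |a k| * |x| ^ k := by
  obtain ⟨C, j, h⟩ := ha
  have h1 : Summable fun k : ℕ => ((k : ℝ) + 1) ^ j * |x| ^ k := by
    rcases eq_or_ne x 0 with rfl | h0
    · refine summable_of_ne_finset_zero (s := {0}) fun k hk => ?_
      simp at hk
      simp [hk]
    have := (summable_nat_add_iff 1).2
      (summable_pow_mul_geometric_of_norm_lt_one j (r := |x|) (by simpa using hx))
    have h2 := this.mul_right (|x|⁻¹)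
    refine h2.congr fun k => ?_
    have : |x| ≠ 0 := by simpa using h0
    push_cast
    rw [pow_succ]
    field_simp
  refine (h1.mul_left C).of_nonneg_of_le (fun k => by positivity) fun k => ?_
  rw [← mul_assoc]
  exact mul_le_mul_of_nonneg_right (h k) (by positivity)

theorem PolyBounded.summable_mul_pow {a : ℕ → ℝ} (ha : PolyBounded a) {x : ℝ} (hx : |x| < 1) :
    Summable fun k => a k * x ^ k :=
  Summable.of_norm ((ha.summable hx).congr fun k => by simp)

theorem PolyBounded.deriv {a : ℕ → ℝ} (ha : PolyBounded a) :
    PolyBounded fun k => ((k : ℝ) + 1) * a (k + 1) := by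
  obtain ⟨C, j, h⟩ := ha
  have hC : 0 ≤ C := by simpa using (abs_nonneg _).trans (h 0)
  refine ⟨C * 2 ^ j, j + 1, fun k => ?_⟩
  rw [abs_mul, abs_of_nonneg (by positivity)]
  calc ((k : ℝ) + 1) * |a (k + 1)| ≤ ((k : ℝ) + 1) * (C * (2 * ((k : ℝ) + 1)) ^ j) := by
        gcongr
        refine (h (k + 1)).trans ?_
        push_cast
        gcongr
        linarith [(Nat.cast_nonneg k : (0 : ℝ) ≤ k)]
    _ = _ := by rw [mul_pow]; ring

theorem PolyBounded.hasDerivAt {a : ℕ → ℝ} (ha : PolyBounded a) {x : ℝ} (hx : |x| < 1) :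
    HasDerivAt (fun y => ∑' k, a k * y ^ k) (∑' k : ℕ, ((k : ℝ) + 1) * a (k + 1) * x ^ k) x := by
  obtain ⟨ρ, hxρ, hρ⟩ := exists_between hx
  have hρ0 : 0 < ρ := (abs_nonneg x).trans_lt hxρ
  have hs := ha.deriv.summable (x := ρ) (by rwa [abs_of_pos hρ0])
  have hu : Summable fun k : ℕ => |a k| * (k * ρ ^ (k - 1)) := by
    rw [← summable_nat_add_iff 1]
    refine hs.congr fun k => ?_
    rw [abs_mul, abs_of_nonneg (by positivity : (0 : ℝ) ≤ k + 1), abs_of_pos hρ0]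
    simp only [Nat.add_sub_cancel]
    push_cast
    ring
  have hbd : ∀ (k : ℕ) (y : ℝ), y ∈ Set.Ioo (-ρ) ρ →
      ‖a k * (k * y ^ (k - 1))‖ ≤ |a k| * (k * ρ ^ (k - 1)) := by
    intro k y hy
    have hy' : |y| ≤ ρ := abs_le.2 ⟨hy.1.le, hy.2.le⟩
    rw [norm_mul, norm_mul, norm_pow]
    simp only [norm_eq_abs, Nat.abs_cast]
    gcongr
  have hd := hasDerivAt_tsum_of_isPreconnected hu isOpen_Ioo isPreconnected_Ioo
    (fun k y _ => (hasDerivAt_pow k y).const_mul (a k)) hbd (y₀ := 0)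
    ⟨by linarith, hρ0⟩ (ha.summable_mul_pow (by simp)) (abs_lt.1 hxρ)
  have h1 : ∑' k : ℕ, a k * (k * x ^ (k - 1)) =
      ∑' k : ℕ, ((k : ℝ) + 1) * a (k + 1) * x ^ k := by
    rw [(Summable.of_norm_bounded hu fun k => hbd k x (abs_lt.1 hxρ)).tsum_eq_zero_add]
    simp only [Nat.cast_zero, zero_mul, mul_zero, zero_add, Nat.cast_add, Nat.cast_one,
      Nat.add_sub_cancel]
    exact tsum_congr fun k => by ring
  exact h1 ▸ hd

/-! ### The profile of the Green function -/

/-- The Taylor coefficients of `₂F₁(n, 1; n/2 + 1; ·)`. -/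
noncomputable def hypCoef (n k : ℕ) : ℝ := poch n k / poch ((n : ℝ) / 2 + 1) k

theorem poch_succ (x : ℝ) (k : ℕ) : poch x (k + 1) = poch x k * (x + k) :=
  Finset.prod_range_succ _ _

theorem poch_pos {x : ℝ} (hx : 0 < x) (k : ℕ) : 0 < poch x k :=
  Finset.prod_pos fun i _ => by positivity

theorem hypCoef_zero (n : ℕ) : hypCoef n 0 = 1 := by simp [hypCoef, poch]

theorem hypCoef_pos {n : ℕ} (hn : 0 < n) (k : ℕ) : 0 < hypCoef n k :=
  div_pos (poch_pos (by positivity) k) (poch_pos (by positivity) k)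

theorem hypCoef_succ (n k : ℕ) :
    ((n : ℝ) / 2 + 1 + k) * hypCoef n (k + 1) = (n + k) * hypCoef n k := by
  have h := (poch_pos (by positivity : 0 < (n : ℝ) / 2 + 1) k).ne'
  have h' : (n : ℝ) / 2 + 1 + k ≠ 0 := by positivity
  rw [hypCoef, hypCoef, poch_succ, poch_succ]
  field_simp

theorem polyBounded_hypCoef {n : ℕ} (hn : 0 < n) : PolyBounded (hypCoef n) := by
  refine ⟨1, n, fun k => ?_⟩
  rw [abs_of_pos (hypCoef_pos hn k), one_mul]
  induction k with
  | zero => simp [hypCoef_zero]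
  | succ k ih =>
    have hk : (0 : ℝ) < k + 1 := by positivity
    have hn' : (1 : ℝ) ≤ n := by exact_mod_cast hn
    have hb : 1 + (n : ℝ) * (1 / (k + 1)) ≤ (1 + 1 / ((k : ℝ) + 1)) ^ n :=
      one_add_mul_le_pow (by linarith [show 0 ≤ 1 / ((k : ℝ) + 1) by positivity]) n
    have h1 : hypCoef n (k + 1) = (n + k) / ((n : ℝ) / 2 + 1 + k) * hypCoef n k := by
      rw [div_mul_eq_mul_div, ← hypCoef_succ]
      field_simp
    have h2 : (n + k) / ((n : ℝ) / 2 + 1 + k) ≤ (1 + 1 / ((k : ℝ) + 1)) ^ n := by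
      refine le_trans ?_ hb
      rw [div_le_iff₀ (by positivity)]
      field_simp
      nlinarith [(Nat.cast_nonneg k : (0 : ℝ) ≤ k)]
    rw [h1]
    calc _ ≤ (1 + 1 / ((k : ℝ) + 1)) ^ n * ((k : ℝ) + 1) ^ n := by
          have := (hypCoef_pos hn k).le
          gcongr
      _ = _ := by
        rw [← mul_pow]
        congr 1
        push_cast
        field_simp

/-- The hypergeometric function `₂F₁(n, 1; n/2 + 1; ·)`. -/
noncomputable def hyp (n : ℕ) (x : ℝ) : ℝ := ∑' k, hypCoef n k * x ^ k

/-- The derivative of `hyp n`. -/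
noncomputable def hypDeriv (n : ℕ) (x : ℝ) : ℝ :=
  ∑' k : ℕ, ((k : ℝ) + 1) * hypCoef n (k + 1) * x ^ k

/-- The antiderivative of `hyp n` vanishing at `0`. -/
noncomputable def greenProfile (n : ℕ) (x : ℝ) : ℝ :=
  ∑' k : ℕ, hypCoef n k / (k + 1) * x ^ (k + 1)

theorem hasDerivAt_hyp {n : ℕ} (hn : 0 < n) {x : ℝ} (hx : |x| < 1) :
    HasDerivAt (hyp n) (hypDeriv n x) x := (polyBounded_hypCoef hn).hasDerivAt hx

theorem continuousOn_hypDeriv {n : ℕ} (hn : 0 < n) :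
    ContinuousOn (hypDeriv n) (Set.Ioo (-1) 1) := fun _ hx =>
  ((polyBounded_hypCoef hn).deriv.hasDerivAt (abs_lt.2 hx)).continuousAt.continuousWithinAt

theorem summable_greenProfile {n : ℕ} (hn : 0 < n) {x : ℝ} (hx : |x| < 1) :
    Summable fun k : ℕ => hypCoef n k / (k + 1) * x ^ (k + 1) := by
  refine Summable.of_norm_bounded (((polyBounded_hypCoef hn).summable hx).mul_right |x|) fun k => ?_
  rw [norm_mul, norm_div, norm_pow, pow_succ, ← mul_assoc]
  simp only [norm_eq_abs]
  gcongr
  exact div_le_self (abs_nonneg _) (by rw [abs_of_pos (by positivity)]; simp)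

theorem hasDerivAt_greenProfile {n : ℕ} (hn : 0 < n) {x : ℝ} (hx : |x| < 1) :
    HasDerivAt (greenProfile n) (hyp n x) x := by
  let a : ℕ → ℝ := fun k => hypCoef n (k - 1) / k
  have ha : PolyBounded a := by
    obtain ⟨C, j, h⟩ := polyBounded_hypCoef hn
    have hC : 0 ≤ C := by simpa using (abs_nonneg _).trans (h 0)
    refine ⟨C, j, fun k => ?_⟩
    rcases k with _ | k
    · simpa [a] using hC
    · simp only [a, Nat.add_sub_cancel]
      rw [abs_div]
      push_cast
      refine (div_le_self (abs_nonneg _) (by rw [abs_of_pos (by positivity)]; simp)).trans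
        ((h k).trans ?_)
      gcongr
      linarith
  have hd := ha.hasDerivAt hx
  have h1 : ∑' k : ℕ, ((k : ℝ) + 1) * a (k + 1) * x ^ k = hyp n x := by
    refine tsum_congr fun k => ?_
    simp only [a, Nat.add_sub_cancel]
    push_cast
    field_simp
  rw [h1] at hd
  refine hd.congr_of_eventuallyEq ?_
  filter_upwards [isOpen_Ioo.mem_nhds (abs_lt.1 hx)] with y hy
  rw [(ha.summable_mul_pow (abs_lt.2 hy)).tsum_eq_zero_add]
  simp [a, greenProfile]

theorem hyp_ode {n : ℕ} (hn : 0 < n) {x : ℝ} (hx : |x| < 1) :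
    x * (1 - x) * hypDeriv n x + n / 2 * (1 - 2 * x) * hyp n x = n / 2 := by
  have hH := ((polyBounded_hypCoef hn).summable_mul_pow hx).hasSum
  have hD := ((polyBounded_hypCoef hn).deriv.summable_mul_pow hx).hasSum
  have hK : HasSum (fun k : ℕ => (k : ℝ) * hypCoef n k * x ^ k) (x * hypDeriv n x) := by
    rw [← hasSum_nat_add_iff' 1]
    simp only [Finset.range_one, Finset.sum_singleton, Nat.cast_zero, zero_mul, sub_zero]
    refine (hD.mul_left x).congr_fun fun k => ?_
    push_cast
    ring
  have h1 := hK.add (hH.mul_left ((n : ℝ) / 2))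
  have h2 := (hK.add (hH.mul_left (n : ℝ))).mul_left x
  have h3 := (hasSum_nat_add_iff' 1).2 h1
  have h4 := h3.unique (h2.congr_fun ?_)
  · simp [hypCoef_zero] at h4
    change _ * hypDeriv n x + _ * hyp n x - _ = _ * (_ + _ * hyp n x) at h4
    linear_combination h4
  · intro k
    have := hypCoef_succ n k
    push_cast
    rw [pow_succ]
    linear_combination (x ^ k * x) * this

/-! ### Averages of the profile over latitude spheres -/

theorem hasDerivAt_intervalIntegral_of_continuousOn {F F' : ℝ → ℝ → ℝ} {U : Set ℝ} (hU : IsOpen U)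
    (hF : ContinuousOn (Function.uncurry F) (U ×ˢ Set.univ))
    (hF' : ContinuousOn (Function.uncurry F') (U ×ˢ Set.univ))
    (hd : ∀ t ∈ U, ∀ s, HasDerivAt (fun t => F t s) (F' t s) t) {t : ℝ} (ht : t ∈ U) (a b : ℝ) :
    HasDerivAt (fun t => ∫ s in a..b, F t s) (∫ s in a..b, F' t s) t := by
  have hc : ∀ {G : ℝ → ℝ → ℝ}, ContinuousOn (Function.uncurry G) (U ×ˢ Set.univ) →
      ∀ t ∈ U, Continuous (G t) := fun {G} hG t ht =>
    hG.comp_continuous (f := fun s : ℝ => (t, s)) (by fun_prop) fun s => ⟨ht, trivial⟩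
  obtain ⟨ε, hε, hεU⟩ := Metric.nhds_basis_closedBall.mem_iff.1 (hU.mem_nhds ht)
  have hK : IsCompact (Metric.closedBall t ε ×ˢ Set.uIcc a b) :=
    (isCompact_closedBall t ε).prod isCompact_uIcc
  obtain ⟨C, hC⟩ := hK.exists_bound_of_continuousOn
    (hF'.mono (Set.prod_mono hεU (Set.subset_univ _)))
  refine (intervalIntegral.hasDerivAt_integral_of_dominated_loc_of_deriv_le
    (bound := fun _ => C) (Metric.closedBall_mem_nhds t hε) ?_
    ((hc hF t ht).intervalIntegrable _ _) (hc hF' t ht).aestronglyMeasurable ?_ (by simp) ?_).2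
  · filter_upwards [hU.mem_nhds ht] with u hu using (hc hF u hu).aestronglyMeasurable
  · exact Eventually.of_forall fun s hs u hu => hC (u, s) ⟨hu, Set.uIoc_subset_uIcc hs⟩
  · exact Eventually.of_forall fun s _ u hu => hd u (hεU hu) s

/-- `(1 + cos δ) / 2`, where `δ` is the third side of a spherical triangle with sides `r`, `t`
enclosing the angle `s`. -/
noncomputable def halfCos (r t s : ℝ) : ℝ := (1 + cos r * cos t + sin r * sin t * cos s) / 2

theorem halfCos_le_max (r t s : ℝ) :
    halfCos r t s ≤ max ((1 + cos (t - r)) / 2) ((1 + cos (t + r)) / 2) := by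
  rw [halfCos, cos_sub, cos_add]
  rcases le_total 0 (sin r * sin t) with h | h
  · exact le_max_of_le_left (by nlinarith [cos_le_one s])
  · exact le_max_of_le_right (by nlinarith [neg_one_le_cos s])

theorem halfCos_nonneg (r t s : ℝ) : 0 ≤ halfCos r t s := by
  have h1 := neg_one_le_cos (t - r)
  have h2 := neg_one_le_cos (t + r)
  rw [cos_sub] at h1
  rw [cos_add] at h2
  rw [halfCos]
  rcases le_total 0 (sin r * sin t) with h | h
  · nlinarith [neg_one_le_cos s]
  · nlinarith [cos_le_one s]

theorem cos_lt_one_of_mem_Ioo {x : ℝ} (hx : x ∈ Set.Ioo 0 (2 * π)) : cos x < 1 := by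
  refine lt_of_le_of_ne (cos_le_one x) fun h => ?_
  have := (cos_eq_one_iff_of_lt_of_lt (by linarith [hx.1, pi_pos]) hx.2).1 h
  exact hx.1.ne' this

theorem halfCos_lt_one {r t : ℝ} (hr : 0 < r) (ht : t ∈ Set.Ioo r (2 * π - r)) (s : ℝ) :
    halfCos r t s < 1 := by
  refine (halfCos_le_max r t s).trans_lt (max_lt ?_ ?_)
  · linarith [cos_lt_one_of_mem_Ioo (x := t - r) ⟨by linarith [ht.1], by linarith [ht.2]⟩]
  · linarith [cos_lt_one_of_mem_Ioo (x := t + r) ⟨by linarith [ht.1], by linarith [ht.2]⟩]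

theorem integral_sin_pow_mul_greenProfile (m : ℕ) {r t : ℝ} (hr : 0 < r) (hrt : r < t)
    (ht : t ≤ π) :
    ∫ s in (0 : ℝ)..π, sin s ^ m * greenProfile (m + 2) (halfCos r t s) =
      (∫ s in (0 : ℝ)..π, sin s ^ m) *
        (greenProfile (m + 2) ((1 + cos t) / 2) + greenProfile (m + 2) ((1 - cos r) / 2)) := by
  set W := ∫ s in (0 : ℝ)..π, sin s ^ m
  set U := Set.Ioo r (2 * π - r)
  have hn : 0 < m + 2 := by omega
  have hx : ∀ u ∈ U, ∀ s, |halfCos r u s| < 1 := fun u hu s => by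
    rw [abs_of_nonneg (halfCos_nonneg r u s)]; exact halfCos_lt_one hr hu s
  have hy : ∀ u ∈ U, |(1 + cos u) / 2| < 1 := fun u hu => by
    have := cos_lt_one_of_mem_Ioo (x := u) ⟨by linarith [hu.1], by linarith [hu.2]⟩
    rw [abs_of_nonneg (by linarith [neg_one_le_cos u])]
    linarith
  let x1 : ℝ → ℝ → ℝ := fun u s => (-cos r * sin u + sin r * cos u * cos s) / 2
  let x2 : ℝ → ℝ → ℝ := fun u s => (-cos r * cos u - sin r * sin u * cos s) / 2
  have hx1 : ∀ u s, HasDerivAt (fun u => halfCos r u s) (x1 u s) u := fun u s => by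
    have := ((((hasDerivAt_cos u).const_mul (cos r)).const_add 1).add
      (((hasDerivAt_sin u).const_mul (sin r)).mul_const (cos s))).div_const 2
    exact this.congr_deriv (by simp only [x1]; ring)
  have hx2 : ∀ u s, HasDerivAt (fun u => x1 u s) (x2 u s) u := fun u s => by
    have := (((hasDerivAt_sin u).const_mul (-cos r)).add
      (((hasDerivAt_cos u).const_mul (sin r)).mul_const (cos s))).div_const 2
    exact this.congr_deriv (by simp only [x2]; ring)
  have hxs : ∀ u s, HasDerivAt (fun s => halfCos r u s) (-(sin r * sin u * sin s) / 2) s :=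
      fun u s => by
    have := (((hasDerivAt_cos s).const_mul (sin r * sin u)).const_add
      (1 + cos r * cos u)).div_const 2
    exact this.congr_deriv (by ring)
  have hcx : Continuous (fun p : ℝ × ℝ => halfCos r p.1 p.2) := by unfold halfCos; fun_prop
  have hcx1 : Continuous (fun p : ℝ × ℝ => x1 p.1 p.2) := by fun_prop
  have hcx2 : Continuous (fun p : ℝ × ℝ => x2 p.1 p.2) := by fun_prop
  have hcomp : ∀ {g : ℝ → ℝ}, ContinuousOn g (Set.Ioo (-1) 1) →
      ContinuousOn (fun p : ℝ × ℝ => g (halfCos r p.1 p.2)) (U ×ˢ Set.univ) := fun {g} hg =>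
    hg.comp hcx.continuousOn fun p hp => abs_lt.1 (hx p.1 hp.1 p.2)
  have hG := hcomp (g := greenProfile (m + 2)) fun z hz =>
    (hasDerivAt_greenProfile hn (abs_lt.2 hz)).continuousAt.continuousWithinAt
  have hH := hcomp (g := hyp (m + 2)) fun z hz =>
    (hasDerivAt_hyp hn (abs_lt.2 hz)).continuousAt.continuousWithinAt
  have hH' := hcomp (continuousOn_hypDeriv hn)
  let A : ℝ → ℝ := fun u => ∫ s in (0 : ℝ)..π, sin s ^ m * greenProfile (m + 2) (halfCos r u s)
  let D : ℝ → ℝ := fun u => ∫ s in (0 : ℝ)..π, sin s ^ m * (hyp (m + 2) (halfCos r u s) * x1 u s)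
  let D2 : ℝ → ℝ := fun u => ∫ s in (0 : ℝ)..π, sin s ^ m *
    (hypDeriv (m + 2) (halfCos r u s) * x1 u s * x1 u s + hyp (m + 2) (halfCos r u s) * x2 u s)
  have hcs : ContinuousOn (fun p : ℝ × ℝ => sin p.2 ^ m) (U ×ˢ Set.univ) := by fun_prop
  have hc1 : ContinuousOn (fun p : ℝ × ℝ => sin p.2 ^ m * (hyp (m + 2) (halfCos r p.1 p.2) *
      x1 p.1 p.2)) (U ×ˢ Set.univ) := hcs.mul (hH.mul hcx1.continuousOn)
  have hc2 : ContinuousOn (fun p : ℝ × ℝ => sin p.2 ^ m * (hypDeriv (m + 2) (halfCos r p.1 p.2) *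
      x1 p.1 p.2 * x1 p.1 p.2 + hyp (m + 2) (halfCos r p.1 p.2) * x2 p.1 p.2)) (U ×ˢ Set.univ) :=
    hcs.mul (((hH'.mul hcx1.continuousOn).mul hcx1.continuousOn).add (hH.mul hcx2.continuousOn))
  have hA : ∀ u ∈ U, HasDerivAt A (D u) u := fun u hu =>
    hasDerivAt_intervalIntegral_of_continuousOn
      (F := fun u s => sin s ^ m * greenProfile (m + 2) (halfCos r u s))
      (F' := fun u s => sin s ^ m * (hyp (m + 2) (halfCos r u s) * x1 u s))
      isOpen_Ioo (hcs.mul hG) hc1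
      (fun u hu s => ((hasDerivAt_greenProfile hn (hx u hu s)).comp u (hx1 u s)).const_mul _)
      hu 0 π
  have hD : ∀ u ∈ U, HasDerivAt D (D2 u) u := fun u hu =>
    hasDerivAt_intervalIntegral_of_continuousOn
      (F := fun u s => sin s ^ m * (hyp (m + 2) (halfCos r u s) * x1 u s))
      (F' := fun u s => sin s ^ m * (hypDeriv (m + 2) (halfCos r u s) * x1 u s * x1 u s +
        hyp (m + 2) (halfCos r u s) * x2 u s))
      isOpen_Ioo hc1 hc2
      (fun u hu s => (((hasDerivAt_hyp hn (hx u hu s)).comp u (hx1 u s)).mul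
        (hx2 u s)).const_mul _) hu 0 π
  have hslice : ∀ {g : ℝ × ℝ → ℝ}, ContinuousOn g (U ×ˢ Set.univ) →
      ∀ u ∈ U, Continuous fun s => g (u, s) := fun {g} hg u hu =>
    hg.comp_continuous (f := fun s : ℝ => (u, s)) (by fun_prop) fun s => ⟨hu, trivial⟩
  have hflux : ∀ u ∈ U, (m + 1) * cos u * D u + sin u * D2 u = W * ((m + 2) / 2) * sin u := by
    intro u hu
    have hS : ∀ s, HasDerivAt (fun s => -(sin s ^ (m + 1) * hyp (m + 2) (halfCos r u s)) *
        (sin r / 2)) (-((m + 1) * sin s ^ m * cos s * hyp (m + 2) (halfCos r u s) +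
          sin s ^ (m + 1) * (hypDeriv (m + 2) (halfCos r u s) *
            (-(sin r * sin u * sin s) / 2))) * (sin r / 2)) s := fun s => by
      have := ((((hasDerivAt_sin s).pow (m + 1)).mul
        ((hasDerivAt_hyp hn (hx u hu s)).comp s (hxs u s))).neg).mul_const (sin r / 2)
      refine this.congr_deriv ?_
      simp only [Nat.add_sub_cancel]
      push_cast
      rfl
    have hcH := hslice hH u hu
    have hcH' := hslice hH' u hu
    have hcS : Continuous fun s => -((m + 1) * sin s ^ m * cos s * hyp (m + 2) (halfCos r u s) +
          sin s ^ (m + 1) * (hypDeriv (m + 2) (halfCos r u s) *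
            (-(sin r * sin u * sin s) / 2))) * (sin r / 2) := by fun_prop
    have hI := intervalIntegral.integral_eq_sub_of_hasDerivAt (fun s _ => hS s)
      (hcS.intervalIntegrable 0 π)
    simp only [sin_pi, sin_zero, ne_eq, Nat.add_eq_zero_iff, one_ne_zero, and_false,
      not_false_eq_true, zero_pow, zero_mul, neg_zero, sub_zero] at hI
    have hi1 : IntervalIntegrable (fun s => sin s ^ m * (hyp (m + 2) (halfCos r u s) * x1 u s))
      volume 0 π := (hslice hc1 u hu).intervalIntegrable 0 π
    have hi2 : IntervalIntegrable (fun s => sin s ^ m * (hypDeriv (m + 2) (halfCos r u s) *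
        x1 u s * x1 u s + hyp (m + 2) (halfCos r u s) * x2 u s)) volume 0 π :=
      (hslice hc2 u hu).intervalIntegrable 0 π
    rw [← add_zero (_ + _), ← hI]
    simp only [D, D2, W]
    rw [← intervalIntegral.integral_const_mul, ← intervalIntegral.integral_const_mul,
      ← intervalIntegral.integral_add (hi1.const_mul _) (hi2.const_mul _),
      ← intervalIntegral.integral_add ((hi1.const_mul _).add (hi2.const_mul _))
        (hcS.intervalIntegrable 0 π), ← intervalIntegral.integral_mul_const,
      ← intervalIntegral.integral_mul_const]
    refine intervalIntegral.integral_congr fun s _ => ?_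
    have hode := hyp_ode hn (hx u hu s)
    push_cast at hode
    have e1 := sin_sq_add_cos_sq r
    have e2 := sin_sq_add_cos_sq u
    have e3 := sin_sq_add_cos_sq s
    simp only [x1, x2]
    generalize hypDeriv (m + 2) (halfCos r u s) = h' at *
    generalize hyp (m + 2) (halfCos r u s) = h at *
    simp only [halfCos] at hode
    linear_combination sin s ^ m * sin u * hode + sin s ^ m * sin u / 4 * h' *
      ((cos r ^ 2 + sin r ^ 2 * cos s ^ 2) * e2 + sin r ^ 2 * e3 + e1) +
      sin s ^ m * h * (m + 1) / 2 * sin r * cos s * e2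
  let Ψ : ℝ → ℝ := fun u => greenProfile (m + 2) ((1 + cos u) / 2)
  have hyd : ∀ u, HasDerivAt (fun u => (1 + cos u) / 2) (-sin u / 2) u := fun u =>
    ((hasDerivAt_cos u).const_add 1).div_const 2
  have hΨ : ∀ u ∈ U, HasDerivAt Ψ (hyp (m + 2) ((1 + cos u) / 2) * (-sin u / 2)) u :=
    fun u hu => HasDerivAt.comp (h₂ := greenProfile (m + 2)) u
      (hasDerivAt_greenProfile hn (hy u hu)) (hyd u)
  have hπ : π ∈ U := ⟨by linarith, by linarith⟩
  have hsub : ∀ u, r < u → Set.Icc u π ⊆ U := fun u hu z hz =>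
    ⟨by linarith [hz.1], by linarith [hz.2]⟩
  have hDeq : ∀ u, r < u → u < π → D u = W * (hyp (m + 2) ((1 + cos u) / 2) * (-sin u / 2)) := by
    intro u hu huπ
    have hder : ∀ z ∈ U, HasDerivAt (fun z => sin z ^ (m + 1) *
        (D z - W * (hyp (m + 2) ((1 + cos z) / 2) * (-sin z / 2)))) 0 z := by
      intro z hz
      have h1 := ((hasDerivAt_hyp hn (hy z hz)).comp z (hyd z)).mul
        ((hasDerivAt_sin z).neg.div_const 2)
      have h2 := ((hasDerivAt_sin z).pow (m + 1)).mul ((hD z hz).sub (h1.const_mul W))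
      refine h2.congr_deriv ?_
      have hode := hyp_ode hn (hy z hz)
      have hf := hflux z hz
      push_cast at hode
      simp only [Nat.add_sub_cancel, Function.comp_apply, Pi.sub_apply, Pi.mul_apply,
        Pi.neg_apply, Pi.pow_apply]
      push_cast
      have e2 := sin_sq_add_cos_sq z
      generalize hypDeriv (m + 2) ((1 + cos z) / 2) = h' at *
      generalize hyp (m + 2) ((1 + cos z) / 2) = h at *
      linear_combination sin z ^ m * hf - W * sin z ^ (m + 1) * hode -
        W * sin z ^ (m + 1) * h' / 4 * e2
    have := constant_of_has_deriv_right_zero (a := u) (b := π)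
      (fun z hz => (hder z (hsub u hu hz)).continuousAt.continuousWithinAt)
      (fun z hz => (hder z (hsub u hu (Set.Ico_subset_Icc_self hz))).hasDerivWithinAt) π
      ⟨huπ.le, le_rfl⟩
    simp only [sin_pi, ne_eq, Nat.add_eq_zero_iff, one_ne_zero, and_false, not_false_eq_true,
      zero_pow, zero_mul] at this
    have hs := sin_pos_of_pos_of_lt_pi (hr.trans hu) huπ
    have h0 := (mul_eq_zero.1 this.symm).resolve_left (pow_pos hs _).ne'
    linarith
  have hconst := constant_of_has_deriv_right_zero (f := fun u => A u - W * Ψ u) (a := t) (b := π)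
    (fun z hz => ((hA z (hsub t hrt hz)).sub
      ((hΨ z (hsub t hrt hz)).const_mul W)).continuousAt.continuousWithinAt)
    (fun z hz => by
      have hz' := hsub t hrt (Set.Ico_subset_Icc_self hz)
      have := (hA z hz').sub ((hΨ z hz').const_mul W)
      rw [hDeq z hz'.1 hz.2, sub_self] at this
      exact this.hasDerivWithinAt) π ⟨ht, le_rfl⟩
  have h0 : Ψ π = 0 := by simp [Ψ, greenProfile]
  have hAπ : A π = W * greenProfile (m + 2) ((1 - cos r) / 2) := by
    simp only [A, halfCos, cos_pi, sin_pi, W]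
    rw [← intervalIntegral.integral_mul_const]
    refine intervalIntegral.integral_congr fun s _ => ?_
    ring_nf
  simp only [h0, hAπ] at hconst
  change A t = W * (Ψ t + _)
  linarith

/-! ### The constants in the Green function -/

theorem incBeta_one_eq_beta {α β : ℝ} (hα : 0 < α) (hβ : 0 < β) :
    incBeta 1 α β = ProbabilityTheory.beta α β := by
  have h : Complex.betaIntegral α β = ((incBeta 1 α β : ℝ) : ℂ) := by
    rw [Complex.betaIntegral, incBeta, ← intervalIntegral.integral_ofReal]
    refine intervalIntegral.integral_congr fun t ht => ?_
    rw [Set.uIcc_of_le zero_le_one] at ht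
    push_cast
    rw [Complex.ofReal_cpow ht.1, Complex.ofReal_cpow (sub_nonneg.2 ht.2)]
    push_cast
    rfl
  rw [ProbabilityTheory.beta_eq_betaIntegralReal α β hα hβ, h, Complex.ofReal_re]

theorem beta_add_one_right {α β : ℝ} (hα : 0 < α) (hβ : 0 < β) :
    (α + β) * ProbabilityTheory.beta α (β + 1) = β * ProbabilityTheory.beta α β := by
  have h := (Gamma_pos_of_pos (add_pos hα hβ)).ne'
  rw [ProbabilityTheory.beta, ProbabilityTheory.beta, ← add_assoc, Gamma_add_one hβ.ne',
    Gamma_add_one (add_pos hα hβ).ne']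
  field_simp

theorem hypCoef_mul_incBeta_div {n : ℕ} (hn : 0 < n) (k : ℕ) :
    hypCoef n k * (incBeta 1 ((n : ℝ) / 2) ((n : ℝ) / 2 + k + 1) /
      incBeta 1 ((n : ℝ) / 2) ((n : ℝ) / 2)) = ((n : ℝ) / 2) / (n + k) := by
  have hn' : (0 : ℝ) < n / 2 := by positivity
  have hb := (ProbabilityTheory.beta_pos hn' hn').ne'
  rw [incBeta_one_eq_beta hn' (by positivity), incBeta_one_eq_beta hn' hn']
  induction k with
  | zero =>
    have := beta_add_one_right hn' hn'
    rw [hypCoef_zero, Nat.cast_zero, add_zero, add_zero, one_mul, div_eq_div_iff hb (by positivity)]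
    linear_combination this
  | succ k ih =>
    have h1 := beta_add_one_right hn' (by positivity : 0 < (n : ℝ) / 2 + k + 1)
    have h2 := hypCoef_succ n k
    have h3 : (n : ℝ) + k ≠ 0 := by positivity
    have h4 : (n : ℝ) / 2 + 1 + k ≠ 0 := by positivity
    rw [mul_div_assoc', div_eq_div_iff hb h3] at ih
    rw [mul_div_assoc', div_eq_div_iff hb (by positivity)]
    push_cast
    rw [← add_assoc] at *
    have h5 : ((n : ℝ) + k) * ((n : ℝ) / 2 + 1 + k) ≠ 0 := mul_ne_zero h3 h4
    refine mul_left_cancel₀ h5 ?_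
    linear_combination (n + k) * ((n : ℝ) / 2 + 1 + k) * hypCoef n (k + 1) * h1 +
      (n + k) * ((n : ℝ) / 2 + k + 1) * ProbabilityTheory.beta (n / 2) (n / 2 + k + 1) * h2 +
      (n + k) * ((n : ℝ) / 2 + k + 1) * ih

theorem summable_hypCoef_mul_incBeta {n : ℕ} (hn : 0 < n) :
    Summable fun k : ℕ => hypCoef n k / (k + 1) *
      (incBeta 1 ((n : ℝ) / 2) ((n : ℝ) / 2 + k + 1) / incBeta 1 ((n : ℝ) / 2) ((n : ℝ) / 2)) := by
  have h := ((summable_nat_add_iff 1).2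
    (Real.summable_one_div_nat_pow.2 one_lt_two)).mul_left ((n : ℝ) / 2)
  refine h.of_norm_bounded fun k => ?_
  rw [div_mul_eq_mul_div, hypCoef_mul_incBeta_div hn, norm_of_nonneg (by positivity), div_div,
    div_eq_mul_one_div ((n : ℝ) / 2)]
  have : (1 : ℝ) ≤ n := by exact_mod_cast hn
  gcongr
  push_cast
  nlinarith [(Nat.cast_nonneg k : (0 : ℝ) ≤ k)]

/-- The mean of the profile of the Green function over the sphere. -/
noncomputable def greenMean (n : ℕ) : ℝ := ∑' k : ℕ, hypCoef n k / (k + 1) *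
  (incBeta 1 ((n : ℝ) / 2) ((n : ℝ) / 2 + k + 1) / incBeta 1 ((n : ℝ) / 2) ((n : ℝ) / 2))

theorem green_eq {n : ℕ} (hn : 0 < n) {t : ℝ} (ht : |1 - t ^ 2 / 4| < 1) :
    green n t = 2 / (n * sphereVol n) * (greenProfile n (1 - t ^ 2 / 4) - greenMean n) := by
  rw [green, greenProfile, greenMean,
    ← (summable_greenProfile hn ht).tsum_sub (summable_hypCoef_mul_incBeta hn)]
  congr 1
  refine tsum_congr fun k => ?_
  rw [hypCoef, div_div, mul_comm ((k : ℝ) + 1), mul_sub]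

theorem incBeta_sin_sq {n : ℕ} (hn : 2 ≤ n) {a : ℝ} (ha : a ∈ Set.Ioo 0 π) (j : ℕ) :
    incBeta (sin (a / 2) ^ 2) ((n : ℝ) / 2 + j) ((n : ℝ) / 2) =
      (1 / 2) ^ (n - 1) * ∫ r in (0 : ℝ)..a, sin r ^ (n - 1) * ((1 - cos r) / 2) ^ j := by
  have hd : ∀ r : ℝ, HasDerivAt (fun r => (1 - cos r) / 2) (sin r / 2) r := fun r =>
    (((hasDerivAt_cos r).const_sub 1).div_const 2).congr_deriv (by ring)
  have h := intervalIntegral.integral_comp_mul_deriv_of_deriv_nonneg (a := 0) (b := a)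
    (f := fun r => (1 - cos r) / 2) (f' := fun r => sin r / 2)
    (g := fun t => t ^ ((n : ℝ) / 2 + j - 1) * (1 - t) ^ ((n : ℝ) / 2 - 1)) (by fun_prop)
    (fun r _ => hd r) (fun r hr => by
      rw [min_eq_left ha.1.le, max_eq_right ha.1.le] at hr
      linarith [sin_pos_of_pos_of_lt_pi hr.1 (hr.2.trans ha.2)])
  have e : sin (a / 2) ^ 2 = (1 - cos a) / 2 := by
    rw [sin_sq_eq_half_sub, mul_div_cancel₀ a two_ne_zero]; ring
  rw [incBeta, e]
  simp only [cos_zero, sub_self, zero_div] at h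
  rw [← h, ← intervalIntegral.integral_const_mul]
  refine intervalIntegral.integral_congr_ae (Eventually.of_forall fun r hr => ?_)
  rw [Set.uIoc_of_le ha.1.le] at hr
  have hs : 0 < sin r := sin_pos_of_pos_of_lt_pi hr.1 (hr.2.trans_lt ha.2)
  have hc : |cos r| < 1 := by
    rw [← sq_lt_one_iff_abs_lt_one]; nlinarith [sin_sq_add_cos_sq r]
  have hc' := abs_lt.1 hc
  obtain ⟨m, rfl⟩ := Nat.exists_eq_add_of_le hn
  have h1 : 0 < (1 - cos r) / 2 := by linarith
  have h2 : 1 - (1 - cos r) / 2 = (1 + cos r) / 2 := by ring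
  have h3 : 0 < (1 + cos r) / 2 := by linarith
  have h4 : (1 - cos r) / 2 * ((1 + cos r) / 2) = (sin r / 2) ^ 2 := by
    linear_combination -(1 / 4) * sin_sq_add_cos_sq r
  have h5 : ((2 + m : ℕ) : ℝ) / 2 + j - 1 = m / 2 + j := by push_cast; ring
  have h6 : ((2 + m : ℕ) : ℝ) / 2 - 1 = m / 2 := by push_cast; ring
  have h7 : 2 + m - 1 = m + 1 := by omega
  simp only [Function.comp_apply]
  rw [h2, h5, h6, h7, rpow_add h1, rpow_natCast, mul_right_comm _ (((1 - cos r) / 2) ^ j),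
    ← mul_rpow h1.le h3.le, h4, ← rpow_natCast (sin r / 2) 2, ← rpow_mul (by positivity)]
  rw [show ((2 : ℕ) : ℝ) * (m / 2) = m by push_cast; ring, rpow_natCast]
  rw [div_pow, pow_succ, pow_succ, one_div, inv_pow]
  field_simp

theorem integral_sin_pow_pos_of_mem_Ioo (m : ℕ) {a : ℝ} (ha : a ∈ Set.Ioo 0 π) :
    0 < ∫ r in (0 : ℝ)..a, sin r ^ m :=
  intervalIntegral.intervalIntegral_pos_of_pos_on ((by fun_prop : Continuous fun r => sin r ^ m)
    |>.intervalIntegrable _ _) (fun r hr =>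
      pow_pos (sin_pos_of_pos_of_lt_pi hr.1 (hr.2.trans ha.2)) _) ha.1

theorem Kfun_eq {n : ℕ} (hn : 2 ≤ n) {a : ℝ} (ha : a ∈ Set.Ioo 0 π) :
    Kfun n a = 2 / (n * sphereVol n) *
      ((∫ r in (0 : ℝ)..a, sin r ^ (n - 1) * greenProfile n ((1 - cos r) / 2)) /
        ∫ r in (0 : ℝ)..a, sin r ^ (n - 1)) := by
  have hX : |(1 - cos a) / 2| < 1 := by
    have := cos_lt_one_of_mem_Ioo (x := π - a) ⟨by linarith [ha.2], by linarith [ha.1, pi_pos]⟩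
    rw [cos_pi_sub] at this
    rw [abs_of_nonneg (by linarith [cos_le_one a])]
    linarith
  have hn0 : 0 < n := by omega
  have hmem : ∀ {r}, r ∈ Set.uIoc 0 a → |(1 - cos r) / 2| ≤ |(1 - cos a) / 2| := fun {r} hr => by
    rw [Set.uIoc_of_le ha.1.le] at hr
    rw [abs_of_nonneg (by linarith [cos_le_one r]), abs_of_nonneg (by linarith [cos_le_one a])]
    linarith [cos_le_cos_of_nonneg_of_le_pi hr.1.le ha.2.le hr.2]
  have hsum := intervalIntegral.hasSum_integral_of_dominated_convergence (a := 0) (b := a)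
    (μ := volume)
    (F := fun (k : ℕ) r => hypCoef n k / (k + 1) * (sin r ^ (n - 1) * ((1 - cos r) / 2) ^ (k + 1)))
    (f := fun r => sin r ^ (n - 1) * greenProfile n ((1 - cos r) / 2))
    (fun k _ => hypCoef n k / (k + 1) * |(1 - cos a) / 2| ^ (k + 1))
    (fun k => (by fun_prop : Continuous _).aestronglyMeasurable)
    (fun k => Eventually.of_forall fun r hr => by
      rw [norm_mul, norm_mul, norm_pow, norm_pow, norm_of_nonneg
        (div_pos (hypCoef_pos hn0 k) (by positivity : (0 : ℝ) < k + 1)).le]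
      have h1 : ‖sin r‖ ^ (n - 1) ≤ 1 := pow_le_one₀ (norm_nonneg _) (abs_sin_le_one r)
      have h2 : ‖(1 - cos r) / 2‖ ^ (k + 1) ≤ |(1 - cos a) / 2| ^ (k + 1) := by
        exact pow_le_pow_left₀ (norm_nonneg _) (hmem hr) _
      have := (hypCoef_pos hn0 k).le
      calc _ ≤ hypCoef n k / (k + 1) * (1 * |(1 - cos a) / 2| ^ (k + 1)) := by gcongr
        _ = _ := by rw [one_mul])
    (Eventually.of_forall fun r _ => summable_greenProfile hn0 (by rwa [abs_abs]))
    (by simp)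
    (Eventually.of_forall fun r hr =>
      ((summable_greenProfile hn0 ((hmem hr).trans_lt hX)).hasSum.mul_left (sin r ^ (n - 1))).congr_fun
        fun k => by ring)
  rw [Kfun, ← hsum.tsum_eq, ← tsum_div_const]
  congr 1
  refine tsum_congr fun k => ?_
  have h0 := incBeta_sin_sq hn ha 0
  have hk := incBeta_sin_sq hn ha (k + 1)
  simp only [pow_zero, mul_one, Nat.cast_zero, add_zero] at h0
  push_cast at hk
  rw [← add_assoc] at hk
  rw [h0, hk, mul_div_mul_left _ _ (by positivity), intervalIntegral.integral_const_mul,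
    mul_div_assoc, hypCoef, div_div]

theorem greenProfile_nonneg {n : ℕ} (hn : 0 < n) {x : ℝ} (hx : 0 ≤ x) : 0 ≤ greenProfile n x :=
  tsum_nonneg fun k => mul_nonneg (div_pos (hypCoef_pos hn k) (by positivity)).le (by positivity)

theorem greenProfile_le {n : ℕ} (hn : 0 < n) {x y : ℝ} (hx : 0 ≤ x) (hxy : x ≤ y) (hy : y < 1) :
    greenProfile n x ≤ greenProfile n y := by
  refine (summable_greenProfile hn (by rw [abs_of_nonneg hx]; linarith)).tsum_le_tsum (fun k => ?_)
    (summable_greenProfile hn (by rw [abs_of_nonneg (hx.trans hxy)]; linarith))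
  have := (hypCoef_pos hn k).le
  gcongr

/-! ### Averages over geodesic spheres and balls -/

/-- `greenProfile` as a nonnegative extended number. -/
noncomputable def egreenProfile (n : ℕ) (x : ℝ) : ENNReal :=
  ∑' k : ℕ, ENNReal.ofReal (hypCoef n k / (k + 1) * x ^ (k + 1))

theorem measurable_egreenProfile (n : ℕ) : Measurable (egreenProfile n) :=
  Measurable.tsum fun k => by fun_prop

theorem egreenProfile_eq {n : ℕ} (hn : 0 < n) {x : ℝ} (hx : 0 ≤ x) (hx1 : x < 1) :
    egreenProfile n x = ENNReal.ofReal (greenProfile n x) :=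
  (ENNReal.ofReal_tsum_of_nonneg (fun k => mul_nonneg
    (div_pos (hypCoef_pos hn k) (by positivity)).le (by positivity))
    (summable_greenProfile hn (by rwa [abs_of_nonneg hx]))).symm

theorem lintegral_Ioo_ofReal {f : ℝ → ℝ} {a b : ℝ} (hab : a ≤ b)
    (hf : IntervalIntegrable f volume a b) (h0 : ∀ x ∈ Set.Ioo a b, 0 ≤ f x) :
    ∫⁻ x in Set.Ioo a b, ENNReal.ofReal (f x) = ENNReal.ofReal (∫ x in a..b, f x) := by
  rw [intervalIntegral.integral_of_le hab, ← restrict_Ioo_eq_restrict_Ioc,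
    ofReal_integral_eq_lintegral_ofReal]
  · exact (intervalIntegrable_iff_integrableOn_Ioo_of_le hab).1 hf
  · exact (ae_restrict_iff' measurableSet_Ioo).2 (Eventually.of_forall h0)

theorem inner_cos_smul_add_sin_smul {E : Type*} [NormedAddCommGroup E] [InnerProductSpace ℝ E]
    {v : E} (hv : ‖v‖ = 1) (r : ℝ) (w : (ℝ ∙ v)ᗮ) :
    ⟪v, cos r • v + sin r • (w : E)⟫ = cos r := by
  rw [inner_add_right, inner_smul_right, inner_smul_right, real_inner_self_eq_norm_sq, hv,
    Submodule.mem_orthogonal_singleton_iff_inner_right.1 w.2]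
  simp

theorem exists_eq_cos_smul_add_sin_smul {E : Type*} [NormedAddCommGroup E]
    [InnerProductSpace ℝ E] {d : ℕ} (hE : Module.finrank ℝ E = d + 2) {v u : E} (hv : ‖v‖ = 1) (hu : ‖u‖ = 1) : ∃ w : (ℝ ∙ v)ᗮ, ‖w‖ = 1 ∧
      u = cos (arccos ⟪v, u⟫) • v + sin (arccos ⟪v, u⟫) • (w : E) := by
  have hle := abs_le.1 (abs_real_inner_le_norm v u)
  rw [hv, hu, one_mul] at hle
  have hc := cos_arccos hle.1 hle.2
  set θ := arccos ⟪v, u⟫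
  have hmem : u - cos θ • v ∈ (ℝ ∙ v)ᗮ := by
    rw [Submodule.mem_orthogonal_singleton_iff_inner_right, inner_sub_right, inner_smul_right,
      real_inner_self_eq_norm_sq, hv, hc]
    simp
  have hnorm : ‖u - cos θ • v‖ ^ 2 = sin θ ^ 2 := by
    rw [norm_sub_sq_real, inner_smul_right, real_inner_comm, norm_smul, hu, hv, hc, norm_eq_abs,
      mul_one, sq_abs, sin_sq, hc]
    ring
  have hs : 0 ≤ sin θ := sin_nonneg_of_nonneg_of_le_pi (arccos_nonneg _) (arccos_le_pi _)
  rw [sq_eq_sq₀ (norm_nonneg _) hs] at hnorm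
  rcases hs.eq_or_lt with h0 | h0
  · have hv0 : v ≠ 0 := by rintro rfl; simp at hv
    have : Fact (Module.finrank ℝ E = d + 1 + 1) := ⟨hE⟩
    have : Nontrivial (ℝ ∙ v)ᗮ := Module.nontrivial_of_finrank_pos (R := ℝ)
      (by rw [Submodule.finrank_orthogonal_span_singleton (n := d + 1) hv0]; omega)
    obtain ⟨w, hw⟩ := exists_norm_eq (ℝ ∙ v)ᗮ zero_le_one
    refine ⟨w, hw, ?_⟩
    rw [← h0, norm_eq_zero, sub_eq_zero] at hnorm
    rw [← h0, zero_smul, add_zero, ← hnorm]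
  · refine ⟨(sin θ)⁻¹ • ⟨_, hmem⟩, ?_, ?_⟩
    · rw [norm_smul, norm_inv, norm_of_nonneg hs]
      change _ * ‖u - cos θ • v‖ = 1
      rw [hnorm, inv_mul_cancel₀ h0.ne']
    · simp only [Submodule.coe_smul, smul_inv_smul₀ h0.ne']
      abel

section

variable {E : Type*} [NormedAddCommGroup E] [InnerProductSpace ℝ E] [FiniteDimensional ℝ E]
  [MeasurableSpace E] [BorelSpace E]

/-- `lintegral_toSphere_eq` for the orthogonal complement of the pole. -/
theorem lintegral_toSphere_eq_orthogonal {d : ℕ} (hE : Module.finrank ℝ E = d + 2) {v : E}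
    (hv : ‖v‖ = 1) {f : E → ENNReal} (hf : Measurable f) :
    ∫⁻ q : Metric.sphere (0 : E) 1, f q ∂(volume : Measure E).toSphere =
      ∫⁻ r in Set.Ioo 0 π, ENNReal.ofReal (sin r ^ d) *
        ∫⁻ ω : Metric.sphere (0 : (ℝ ∙ v)ᗮ) 1, f (cos r • v + sin r • (ω : (ℝ ∙ v)ᗮ))
          ∂(volume : Measure (ℝ ∙ v)ᗮ).toSphere := by
  have hv0 : v ≠ 0 := by rintro rfl; simp at hv
  have : Fact (Module.finrank ℝ E = d + 1 + 1) := ⟨hE⟩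
  exact lintegral_toSphere_eq (Submodule.finrank_orthogonal_span_singleton hv0) hE
    (ℝ ∙ v)ᗮ.subtypeₗᵢ v hv (fun w => Submodule.mem_orthogonal_singleton_iff_inner_right.1 w.2) hf

theorem toSphere_singleton {d : ℕ} (hE : Module.finrank ℝ E = d + 2)
    (v : Metric.sphere (0 : E) 1) : (volume : Measure E).toSphere {v} = 0 := by
  have hv : ‖(v : E)‖ = 1 := norm_eq_of_mem_sphere v
  rw [← lintegral_indicator_one (measurableSet_singleton v)]
  have h := lintegral_toSphere_eq_orthogonal hE hv
    (measurable_one.indicator (measurableSet_singleton (v : E)))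
  have h1 : ∀ q : Metric.sphere (0 : E) 1, ({(v : E)} : Set E).indicator (1 : E → ENNReal) q =
      ({v} : Set (Metric.sphere (0 : E) 1)).indicator 1 q := fun q => by
    by_cases hq : q = v
    · simp [hq]
    · simp [hq, Subtype.coe_injective.ne hq]
  simp only [h1] at h
  rw [h]
  refine (setLIntegral_congr_fun (g := fun _ => 0) measurableSet_Ioo fun r hr => ?_).trans (by simp)
  have h2 : ∀ w : (ℝ ∙ (v : E))ᗮ, cos r • (v : E) + sin r • (w : E) ∉ ({(v : E)} : Set E) := by
    intro w hw
    have := inner_cos_smul_add_sin_smul hv r w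
    rw [Set.mem_singleton_iff.1 hw, real_inner_self_eq_norm_sq, hv] at this
    have := cos_lt_one_of_mem_Ioo (x := r) ⟨hr.1, by linarith [hr.2, pi_pos]⟩
    linarith
  simp [Set.indicator_of_notMem (h2 _)]

theorem toSphere_univ {d : ℕ} (hE : Module.finrank ℝ E = d + 2) :
    (volume : Measure E).toSphere Set.univ = ENNReal.ofReal (sphereVol (d + 1)) := by
  have : Nontrivial E := Module.nontrivial_of_finrank_pos (R := ℝ) (by omega)
  rw [Measure.toSphere_apply_univ, InnerProductSpace.volume_ball, hE, ENNReal.ofReal_one, one_pow,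
    one_mul, ← ENNReal.ofReal_natCast, ← ENNReal.ofReal_mul (by positivity), sphereVol]
  congr 1
  have h : (((d + 1 : ℕ) : ℝ) + 1) / 2 = ((d + 2 : ℕ) : ℝ) / 2 := by push_cast; ring
  have h0 : ((d + 2 : ℕ) : ℝ) / 2 ≠ 0 := by positivity
  rw [h, Gamma_add_one h0, sqrt_eq_rpow, ← rpow_natCast, ← rpow_mul pi_pos.le, one_div,
    inv_mul_eq_div]
  have := (Gamma_pos_of_pos (by positivity : 0 < ((d + 2 : ℕ) : ℝ) / 2)).ne'
  field_simp

theorem lintegral_sphere_egreenProfile {m : ℕ} (hE : Module.finrank ℝ E = m + 2) {v : E}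
    (hv : ‖v‖ = 1) {r t : ℝ} (hr : 0 < r) (hrt : r < t) (ht : t ≤ π) :
    ∫⁻ ω : Metric.sphere (0 : E) 1,
        egreenProfile (m + 2) ((1 + cos r * cos t + sin r * sin t * ⟪v, (ω : E)⟫) / 2)
          ∂(volume : Measure E).toSphere =
      ENNReal.ofReal (sphereVol (m + 1)) * ENNReal.ofReal
        (greenProfile (m + 2) ((1 + cos t) / 2) + greenProfile (m + 2) ((1 - cos r) / 2)) := by
  have htU : t ∈ Set.Ioo r (2 * π - r) := ⟨hrt, by linarith⟩
  have hone := lintegral_toSphere_eq_orthogonal hE hv (f := fun _ => 1) measurable_const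
  have hf := lintegral_toSphere_eq_orthogonal hE hv
    (f := fun w => egreenProfile (m + 2) ((1 + cos r * cos t + sin r * sin t * ⟪v, w⟫) / 2))
    ((measurable_egreenProfile _).comp (by fun_prop))
  have hcont : Continuous fun s => greenProfile (m + 2) (halfCos r t s) := by
    rw [continuous_iff_continuousAt]
    intro s
    refine ContinuousAt.comp (f := halfCos r t) (hasDerivAt_greenProfile (by omega) ?_).continuousAt
      (by unfold halfCos; fun_prop)
    rw [abs_of_nonneg (halfCos_nonneg _ _ _)]
    exact halfCos_lt_one hr htU s
  have hs0 : ∀ s ∈ Set.Ioo 0 π, 0 ≤ sin s ^ m := fun s hs =>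
    pow_nonneg (sin_pos_of_mem_Ioo hs).le m
  simp only [lintegral_const, one_mul] at hone
  rw [lintegral_mul_const _ (by fun_prop), lintegral_Ioo_ofReal pi_pos.le
    ((by fun_prop : Continuous fun s => sin s ^ m).intervalIntegrable _ _) hs0,
    toSphere_univ hE] at hone
  simp only [inner_cos_smul_add_sin_smul hv, lintegral_const] at hf
  rw [hf, hone]
  have hm : Measurable fun s => ENNReal.ofReal (sin s ^ m) *
      egreenProfile (m + 2) ((1 + cos r * cos t + sin r * sin t * cos s) / 2) :=
    Measurable.mul (by fun_prop) ((measurable_egreenProfile _).comp (by fun_prop))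
  simp only [← mul_assoc]
  rw [lintegral_mul_const _ hm,
    setLIntegral_congr_fun (g := fun s => ENNReal.ofReal (sin s ^ m *
      greenProfile (m + 2) (halfCos r t s))) measurableSet_Ioo fun s hs => ?_,
    lintegral_Ioo_ofReal pi_pos.le (Continuous.intervalIntegrable (by fun_prop) _ _)
      fun s hs => mul_nonneg (hs0 s hs) (greenProfile_nonneg (by omega) (halfCos_nonneg _ _ _)),
    integral_sin_pow_mul_greenProfile m hr hrt ht, ENNReal.ofReal_mul, mul_right_comm]
  · exact intervalIntegral.integral_nonneg pi_pos.le fun s hs =>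
      pow_nonneg (sin_nonneg_of_mem_Icc hs) m
  · beta_reduce
    rw [ENNReal.ofReal_mul (hs0 s hs), ← egreenProfile_eq (by omega) (halfCos_nonneg _ _ _)
      (halfCos_lt_one hr htU s)]
    rfl

theorem lintegral_geodesicBall {d : ℕ} (hE : Module.finrank ℝ E = d + 2) {v : E} (hv : ‖v‖ = 1)
    {a : ℝ} (ha : a ≤ π) {f : E → ENNReal} (hf : Measurable f) :
    ∫⁻ q : Metric.sphere (0 : E) 1 in {q | arccos ⟪v, (q : E)⟫ < a}, f q
        ∂(volume : Measure E).toSphere =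
      ∫⁻ r in Set.Ioo 0 a, ENNReal.ofReal (sin r ^ d) *
        ∫⁻ ω : Metric.sphere (0 : (ℝ ∙ v)ᗮ) 1, f (cos r • v + sin r • (ω : (ℝ ∙ v)ᗮ))
          ∂(volume : Measure (ℝ ∙ v)ᗮ).toSphere := by
  have hS : MeasurableSet {q : E | arccos ⟪v, q⟫ < a} :=
    measurableSet_lt (by fun_prop) measurable_const
  have hS' : MeasurableSet {q : Metric.sphere (0 : E) 1 | arccos ⟪v, (q : E)⟫ < a} :=
    measurable_subtype_coe hS
  rw [← lintegral_indicator hS']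
  have h := lintegral_toSphere_eq_orthogonal hE hv (hf.indicator hS)
  refine h.trans ?_
  rw [setLIntegral_congr_fun (g := (Set.Iio a).indicator fun r => ENNReal.ofReal (sin r ^ d) *
        ∫⁻ ω : Metric.sphere (0 : (ℝ ∙ v)ᗮ) 1, f (cos r • v + sin r • (ω : (ℝ ∙ v)ᗮ))
          ∂(volume : Measure (ℝ ∙ v)ᗮ).toSphere) measurableSet_Ioo fun r hr => ?_,
    setLIntegral_indicator measurableSet_Iio]
  · congr 2
    ext r
    simp only [Set.mem_inter_iff, Set.mem_Iio, Set.mem_Ioo]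
    constructor
    · exact fun h => ⟨h.2.1, h.1⟩
    · exact fun h => ⟨h.2, h.1, h.2.trans_le ha⟩
  · have h1 : ∀ w : (ℝ ∙ v)ᗮ, arccos ⟪v, cos r • v + sin r • (w : E)⟫ = r := fun w => by
      rw [inner_cos_smul_add_sin_smul hv, arccos_cos hr.1.le hr.2.le]
    by_cases hra : r < a <;> simp [Set.indicator, h1, hra]

/-- The mean of `q ↦ greenProfile n ((1 + cos (dist p q)) / 2)` over a geodesic sphere of radius `r`
whose center has distance `t` from `p`. -/
noncomputable def latitudeMean (n : ℕ) (t r : ℝ) : ℝ :=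
  greenProfile n ((1 + cos (max r t)) / 2) + greenProfile n ((1 - cos (min r t)) / 2)

theorem latitudeMean_nonneg {n : ℕ} (hn : 0 < n) (t r : ℝ) : 0 ≤ latitudeMean n t r :=
  add_nonneg (greenProfile_nonneg hn (by linarith [neg_one_le_cos (max r t)]))
    (greenProfile_nonneg hn (by linarith [cos_le_one (min r t)]))

theorem half_one_add_cos_lt_one {x : ℝ} (h0 : 0 < x) (hπ : x ≤ π) : (1 + cos x) / 2 < 1 := by
  linarith [cos_lt_one_of_mem_Ioo (x := x) ⟨h0, by linarith [pi_pos]⟩]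

theorem half_one_sub_cos_lt_one {x : ℝ} (h0 : 0 ≤ x) (hπ : x < π) : (1 - cos x) / 2 < 1 := by
  have := half_one_add_cos_lt_one (x := π - x) (by linarith) (by linarith)
  rwa [cos_pi_sub, ← sub_eq_add_neg] at this

theorem continuousOn_greenProfile {n : ℕ} (hn : 0 < n) :
    ContinuousOn (greenProfile n) (Set.Ico 0 1) := fun x hx =>
  (hasDerivAt_greenProfile hn
    (by rw [abs_of_nonneg hx.1]; exact hx.2)).continuousAt.continuousWithinAt

theorem continuousOn_latitudeMean {n : ℕ} (hn : 0 < n) {t a : ℝ} (ht : 0 < t) (htπ : t ≤ π)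
    (ha : a < π) : ContinuousOn (latitudeMean n t) (Set.Icc 0 a) := by
  refine ContinuousOn.add ((continuousOn_greenProfile hn).comp (by fun_prop) fun r hr =>
      ⟨by linarith [neg_one_le_cos (max r t)], half_one_add_cos_lt_one (lt_max_of_lt_right ht)
        (max_le (hr.2.trans ha.le) htπ)⟩)
    ((continuousOn_greenProfile hn).comp (by fun_prop) fun r hr =>
      ⟨by linarith [cos_le_one (min r t)], half_one_sub_cos_lt_one (le_min hr.1 ht.le)
        ((min_le_left _ _).trans_lt (hr.2.trans_lt ha))⟩)

theorem lintegral_geodesicBall_egreenProfile {m : ℕ} (hE : Module.finrank ℝ E = m + 3) {v u : E}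
    (hv : ‖v‖ = 1) (hu : ‖u‖ = 1) (hθ : 0 < arccos ⟪v, u⟫) {a : ℝ} (ha : a ∈ Set.Ioo 0 π) :
    ∫⁻ q : Metric.sphere (0 : E) 1 in {q | arccos ⟪v, (q : E)⟫ < a},
        egreenProfile (m + 2) ((1 + ⟪u, (q : E)⟫) / 2) ∂(volume : Measure E).toSphere =
      ENNReal.ofReal (sphereVol (m + 1)) * ENNReal.ofReal
        (∫ r in (0 : ℝ)..a, sin r ^ (m + 1) * latitudeMean (m + 2) (arccos ⟪v, u⟫) r) := by
  have hv0 : v ≠ 0 := by rintro rfl; simp at hv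
  have : Fact (Module.finrank ℝ E = m + 2 + 1) := ⟨hE⟩
  have hF : Module.finrank ℝ (ℝ ∙ v)ᗮ = m + 2 := Submodule.finrank_orthogonal_span_singleton hv0
  obtain ⟨w, hw, huw⟩ := exists_eq_cos_smul_add_sin_smul (d := m + 1) hE hv hu
  have hn : 0 < m + 2 := by omega
  rw [lintegral_geodesicBall (d := m + 1) hE hv ha.2.le
    (f := fun q => egreenProfile (m + 2) ((1 + ⟪u, q⟫) / 2))
    ((measurable_egreenProfile _).comp (by fun_prop))]
  have hθπ := arccos_le_pi ⟪v, u⟫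
  set θ := arccos ⟪v, u⟫
  have hinner : ∀ (r : ℝ) (ω : (ℝ ∙ v)ᗮ), ⟪u, cos r • v + sin r • (ω : E)⟫ =
      cos r * cos θ + sin r * sin θ * ⟪w, ω⟫ := fun r ω => by
    have h1 := Submodule.mem_orthogonal_singleton_iff_inner_right.1 ω.2
    have h2 := Submodule.mem_orthogonal_singleton_iff_inner_left.1 w.2
    rw [huw, inner_add_left, inner_smul_left, inner_smul_left, inner_cos_smul_add_sin_smul hv,
      inner_add_right, inner_smul_right, inner_smul_right, h2, Submodule.coe_inner]
    simp
    ring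
  have hs : ∀ r ∈ Set.Ioo 0 a, 0 ≤ sin r ^ (m + 1) := fun r hr =>
    pow_nonneg (sin_pos_of_pos_of_lt_pi hr.1 (hr.2.trans ha.2)).le _
  have hcont : ContinuousOn (fun r => sin r ^ (m + 1) * latitudeMean (m + 2) θ r)
      (Set.Icc 0 a) :=
    (by fun_prop : Continuous fun r => sin r ^ (m + 1)).continuousOn.mul
      (continuousOn_latitudeMean hn hθ hθπ ha.2)
  rw [← lintegral_Ioo_ofReal ha.1.le (hcont.intervalIntegrable_of_Icc ha.1.le)
    fun r hr => mul_nonneg (hs r hr) (latitudeMean_nonneg hn _ _),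
    ← lintegral_const_mul' _ _ ENNReal.ofReal_ne_top]
  refine lintegral_congr_ae ((ae_restrict_iff' measurableSet_Ioo).2 ?_)
  filter_upwards [compl_mem_ae_iff.2 (measure_singleton θ)] with r hr hra
  simp only [hinner, ← add_assoc]
  rw [ENNReal.ofReal_mul (hs r hra), mul_left_comm]
  congr 1
  rw [latitudeMean]
  rcases lt_or_gt_of_ne hr with h | h
  · rw [max_eq_right h.le, min_eq_left h.le]
    exact lintegral_sphere_egreenProfile hF hw hra.1 h hθπ
  · rw [max_eq_left h.le, min_eq_right h.le,
      ← lintegral_sphere_egreenProfile hF hw hθ h (hra.2.trans ha.2).le]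
    simp only [mul_comm]

theorem toSphere_geodesicBall {d : ℕ} (hE : Module.finrank ℝ E = d + 3) {v : E} (hv : ‖v‖ = 1)
    {a : ℝ} (ha : a ∈ Set.Ioo 0 π) :
    (volume : Measure E).toSphere {q | arccos ⟪v, (q : E)⟫ < a} =
      ENNReal.ofReal (sphereVol (d + 1)) * ENNReal.ofReal (∫ r in (0 : ℝ)..a, sin r ^ (d + 1)) := by
  have hv0 : v ≠ 0 := by rintro rfl; simp at hv
  have : Fact (Module.finrank ℝ E = d + 2 + 1) := ⟨hE⟩
  have hF : Module.finrank ℝ (ℝ ∙ v)ᗮ = d + 2 := Submodule.finrank_orthogonal_span_singleton hv0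
  have h := lintegral_geodesicBall (d := d + 1) hE hv ha.2.le (f := fun _ => 1) measurable_const
  simp only [lintegral_const, one_mul, Measure.restrict_apply_univ] at h
  rw [h, lintegral_mul_const _ (by fun_prop), lintegral_Ioo_ofReal ha.1.le
    ((by fun_prop : Continuous fun s => sin s ^ (d + 1)).intervalIntegrable _ _) fun r hr =>
      pow_nonneg (sin_pos_of_pos_of_lt_pi hr.1 (hr.2.trans ha.2)).le _, toSphere_univ hF, mul_comm]

end

theorem sphereVol_pos (n : ℕ) : 0 < sphereVol n := by
  have := Gamma_pos_of_pos (by positivity : 0 < ((n : ℝ) + 1) / 2)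
  unfold sphereVol
  positivity

theorem green_norm_sub {E : Type*} [NormedAddCommGroup E] [InnerProductSpace ℝ E] {n : ℕ}
    (hn : 0 < n) {p q : E} (hp : ‖p‖ = 1) (hq : ‖q‖ = 1) (hne : p ≠ q) :
    0 ≤ (1 + ⟪p, q⟫) / 2 ∧ (1 + ⟪p, q⟫) / 2 < 1 ∧ green n ‖p - q‖ =
      2 / (n * sphereVol n) * (greenProfile n ((1 + ⟪p, q⟫) / 2) - greenMean n) := by
  have h1 := (inner_lt_one_iff_real_of_norm_eq_one hp hq).2 hne
  have h2 := (abs_le.1 (abs_real_inner_le_norm p q)).1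
  rw [hp, hq, one_mul] at h2
  have h3 : 1 - ‖p - q‖ ^ 2 / 4 = (1 + ⟪p, q⟫) / 2 := by
    rw [norm_sub_sq_real, hp, hq]; ring
  refine ⟨by linarith, by linarith, ?_⟩
  rw [green_eq hn (by rw [h3, abs_lt]; constructor <;> linarith), h3]

theorem integral_geodesicBall_green (m : ℕ)
    (p₀ p : Metric.sphere (0 : EuclideanSpace ℝ (Fin (m + 2 + 1))) 1) (hne : p ≠ p₀)
    {a : ℝ} (ha : a ∈ Set.Ioo 0 π) :
    ∫ q in {q : Metric.sphere (0 : EuclideanSpace ℝ (Fin (m + 2 + 1))) 1 |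
        arccos ⟪(p₀ : EuclideanSpace ℝ (Fin (m + 2 + 1))), (q : EuclideanSpace ℝ (Fin (m + 2 + 1)))⟫
          < a},
      green (m + 2) ‖(p : EuclideanSpace ℝ (Fin (m + 2 + 1))) -
        (q : EuclideanSpace ℝ (Fin (m + 2 + 1)))‖ ∂(sphereMeasure (m + 2)) =
      2 / ((m + 2 : ℕ) * sphereVol (m + 2)) * (sphereVol (m + 1) *
        ((∫ r in (0 : ℝ)..a, sin r ^ (m + 1) * latitudeMean (m + 2)
          (arccos ⟪(p₀ : EuclideanSpace ℝ (Fin (m + 2 + 1))), p⟫) r) -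
          greenMean (m + 2) * ∫ r in (0 : ℝ)..a, sin r ^ (m + 1))) := by
  have hE : Module.finrank ℝ (EuclideanSpace ℝ (Fin (m + 2 + 1))) = m + 3 := by simp
  have hp := norm_eq_of_mem_sphere p
  have hp₀ := norm_eq_of_mem_sphere p₀
  have hn : 0 < m + 2 := by omega
  have hlt := (inner_lt_one_iff_real_of_norm_eq_one hp₀ hp).2
    (Subtype.coe_injective.ne hne.symm)
  have hθ := arccos_pos.2 hlt
  have hlint := lintegral_geodesicBall_egreenProfile hE hp₀ hp hθ ha
  have hvol := toSphere_geodesicBall hE hp₀ ha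
  set A := ∫ r in (0 : ℝ)..a, sin r ^ (m + 1) * latitudeMean (m + 2)
    (arccos ⟪(p₀ : EuclideanSpace ℝ (Fin (m + 2 + 1))), p⟫) r
  have hA : 0 ≤ A := intervalIntegral.integral_nonneg ha.1.le fun r hr =>
    mul_nonneg (pow_nonneg (sin_nonneg_of_nonneg_of_le_pi hr.1 (hr.2.trans ha.2.le)) _)
      (latitudeMean_nonneg hn _ _)
  have hI := integral_sin_pow_pos_of_mem_Ioo (m + 1) ha
  set B := {q : Metric.sphere (0 : EuclideanSpace ℝ (Fin (m + 2 + 1))) 1 |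
    arccos ⟪(p₀ : EuclideanSpace ℝ (Fin (m + 2 + 1))), (q : EuclideanSpace ℝ (Fin (m + 2 + 1)))⟫ < a}
  have hmeas : Measurable fun q : Metric.sphere (0 : EuclideanSpace ℝ (Fin (m + 2 + 1))) 1 =>
      egreenProfile (m + 2) ((1 + ⟪(p : EuclideanSpace ℝ (Fin (m + 2 + 1))),
        (q : EuclideanSpace ℝ (Fin (m + 2 + 1)))⟫) / 2) :=
    (measurable_egreenProfile _).comp (by fun_prop)
  have hfin : ENNReal.ofReal (sphereVol (m + 1)) * ENNReal.ofReal A ≠ ⊤ :=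
    ENNReal.mul_ne_top ENNReal.ofReal_ne_top ENNReal.ofReal_ne_top
  have hcongr : ∀ᵐ q : Metric.sphere (0 : EuclideanSpace ℝ (Fin (m + 2 + 1))) 1
      ∂((sphereMeasure (m + 2)).restrict B),
      green (m + 2) ‖(p : EuclideanSpace ℝ (Fin (m + 2 + 1))) -
        (q : EuclideanSpace ℝ (Fin (m + 2 + 1)))‖ =
      2 / ((m + 2 : ℕ) * sphereVol (m + 2)) * ((egreenProfile (m + 2)
        ((1 + ⟪(p : EuclideanSpace ℝ (Fin (m + 2 + 1))),
          (q : EuclideanSpace ℝ (Fin (m + 2 + 1)))⟫) / 2)).toReal - greenMean (m + 2)) := by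
    refine ae_restrict_of_ae ?_
    filter_upwards [compl_mem_ae_iff.2 (toSphere_singleton (d := m + 1) hE p)] with q hq
    have hq' : (p : EuclideanSpace ℝ (Fin (m + 2 + 1))) ≠ q :=
      Subtype.coe_injective.ne (Ne.symm hq)
    obtain ⟨h0, h1, h2⟩ := green_norm_sub hn hp (norm_eq_of_mem_sphere q) hq'
    rw [h2, egreenProfile_eq hn h0 h1, ENNReal.toReal_ofReal (greenProfile_nonneg hn h0)]
  have : IsFiniteMeasure (sphereMeasure (m + 2)) := by unfold sphereMeasure; infer_instance
  change ∫⁻ q in B, _ ∂(sphereMeasure (m + 2)) = _ at hlint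
  change sphereMeasure (m + 2) B = _ at hvol
  rw [integral_congr_ae hcongr, integral_const_mul, integral_sub
    (integrable_toReal_of_lintegral_ne_top hmeas.aemeasurable (hlint ▸ hfin))
    (integrable_const _), integral_toReal hmeas.aemeasurable
    (ae_lt_top hmeas (hlint ▸ hfin)), hlint, integral_const, measureReal_def,
    Measure.restrict_apply_univ, hvol, ENNReal.toReal_mul, ENNReal.toReal_mul,
    ENNReal.toReal_ofReal hA, ENNReal.toReal_ofReal hI.le,
    ENNReal.toReal_ofReal (sphereVol_pos _).le, smul_eq_mul]
  ring

theorem latitudeMean_eq_of_le {n : ℕ} {t r : ℝ} (h : r ≤ t) : latitudeMean n t r =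
    greenProfile n ((1 + cos t) / 2) + greenProfile n ((1 - cos r) / 2) := by
  rw [latitudeMean, max_eq_right h, min_eq_left h]

theorem latitudeMean_le {n : ℕ} (hn : 0 < n) {t r : ℝ} (ht : 0 < t) (hr : 0 ≤ r) (hrπ : r < π) :
    latitudeMean n t r ≤ greenProfile n ((1 + cos t) / 2) + greenProfile n ((1 - cos r) / 2) := by
  rcases le_total r t with h | h
  · exact (latitudeMean_eq_of_le h).le
  · have hc := cos_le_cos_of_nonneg_of_le_pi ht.le hrπ.le h
    rw [latitudeMean, max_eq_left h, min_eq_right h]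
    exact add_le_add
      (greenProfile_le hn (by linarith [neg_one_le_cos r]) (by linarith)
        (half_one_add_cos_lt_one ht (h.trans hrπ.le)))
      (greenProfile_le hn (by linarith [cos_le_one t]) (by linarith)
        (half_one_sub_cos_lt_one hr hrπ))

theorem stmt_16 (n : ℕ) (hn : 2 ≤ n)
    (p₀ p : Metric.sphere (0 : EuclideanSpace ℝ (Fin (n + 1))) 1) (hne : p ≠ p₀)
    (a : ℝ) (ha : a ∈ Set.Ioo 0 π) :
    (1 / ballVol n a *
        ∫ q in {q : Metric.sphere (0 : EuclideanSpace ℝ (Fin (n + 1))) 1 |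
            Real.arccos ⟪(p₀ : EuclideanSpace ℝ (Fin (n + 1))), (q : EuclideanSpace ℝ (Fin (n + 1)))⟫ < a},
          green n ‖(p : EuclideanSpace ℝ (Fin (n + 1))) - (q : EuclideanSpace ℝ (Fin (n + 1)))‖
            ∂(sphereMeasure n) ≤
      green n ‖(p : EuclideanSpace ℝ (Fin (n + 1))) - (p₀ : EuclideanSpace ℝ (Fin (n + 1)))‖
        + Kfun n a) ∧
    (a ≤ Real.arccos ⟪(p₀ : EuclideanSpace ℝ (Fin (n + 1))), (p : EuclideanSpace ℝ (Fin (n + 1)))⟫ →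
      1 / ballVol n a *
          ∫ q in {q : Metric.sphere (0 : EuclideanSpace ℝ (Fin (n + 1))) 1 |
              Real.arccos ⟪(p₀ : EuclideanSpace ℝ (Fin (n + 1))), (q : EuclideanSpace ℝ (Fin (n + 1)))⟫ < a},
            green n ‖(p : EuclideanSpace ℝ (Fin (n + 1))) - (q : EuclideanSpace ℝ (Fin (n + 1)))‖
              ∂(sphereMeasure n) =
        green n ‖(p : EuclideanSpace ℝ (Fin (n + 1))) - (p₀ : EuclideanSpace ℝ (Fin (n + 1)))‖
          + Kfun n a) := by
  obtain ⟨m, rfl⟩ := Nat.exists_eq_add_of_le' hn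
  have hn0 : 0 < m + 2 := by omega
  have hp := norm_eq_of_mem_sphere p
  have hp₀ := norm_eq_of_mem_sphere p₀
  have hlt := (inner_lt_one_iff_real_of_norm_eq_one hp₀ hp).2
    (Subtype.coe_injective.ne hne.symm)
  have hθ := arccos_pos.2 hlt
  have hθπ := arccos_le_pi ⟪(p₀ : EuclideanSpace ℝ (Fin (m + 2 + 1))), p⟫
  obtain ⟨h0, -, hgreen⟩ := green_norm_sub hn0 hp hp₀ (Subtype.coe_injective.ne hne)
  rw [integral_geodesicBall_green m p₀ p hne ha, hgreen, Kfun_eq hn ha, ballVol,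
    real_inner_comm (p₀ : EuclideanSpace ℝ (Fin (m + 2 + 1)))]
  rw [real_inner_comm (p₀ : EuclideanSpace ℝ (Fin (m + 2 + 1)))] at h0
  rw [← cos_arccos (x := ⟪(p₀ : EuclideanSpace ℝ (Fin (m + 2 + 1))), p⟫) (by linarith) hlt.le,
    arccos_cos hθ.le hθπ]
  set θ := arccos ⟪(p₀ : EuclideanSpace ℝ (Fin (m + 2 + 1))), p⟫
  have hI := integral_sin_pow_pos_of_mem_Ioo (m + 1) ha
  have hV := sphereVol_pos (m + 1)
  have hC : 0 ≤ 2 / ((m + 2 : ℕ) * sphereVol (m + 2)) := by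
    have := sphereVol_pos (m + 2)
    positivity
  rw [show m + 2 - 1 = m + 1 by omega]
  set I := ∫ r in (0 : ℝ)..a, sin r ^ (m + 1)
  set C := 2 / ((m + 2 : ℕ) * sphereVol (m + 2))
  have hcont : ContinuousOn (fun r => sin r ^ (m + 1) * latitudeMean (m + 2) θ r)
      (Set.Icc 0 a) :=
    (by fun_prop : Continuous fun r => sin r ^ (m + 1)).continuousOn.mul
      (continuousOn_latitudeMean hn0 hθ hθπ ha.2)
  have hcontK : ContinuousOn (fun r => sin r ^ (m + 1) * greenProfile (m + 2) ((1 - cos r) / 2))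
      (Set.Icc 0 a) :=
    (by fun_prop : Continuous fun r => sin r ^ (m + 1)).continuousOn.mul
      ((continuousOn_greenProfile hn0).comp (by fun_prop) fun r hr =>
        ⟨by linarith [cos_le_one r], half_one_sub_cos_lt_one hr.1 (hr.2.trans_lt ha.2)⟩)
  have hsinI : IntervalIntegrable (fun r => sin r ^ (m + 1)) volume 0 a :=
    Continuous.intervalIntegrable (by fun_prop) _ _
  have hsum : ∫ r in (0 : ℝ)..a, (sin r ^ (m + 1) * greenProfile (m + 2) ((1 + cos θ) / 2) +
      sin r ^ (m + 1) * greenProfile (m + 2) ((1 - cos r) / 2)) =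
      I * greenProfile (m + 2) ((1 + cos θ) / 2) +
        ∫ r in (0 : ℝ)..a, sin r ^ (m + 1) * greenProfile (m + 2) ((1 - cos r) / 2) := by
    rw [intervalIntegral.integral_add (hsinI.mul_const _)
      (hcontK.intervalIntegrable_of_Icc ha.1.le), intervalIntegral.integral_mul_const]
  set A := ∫ r in (0 : ℝ)..a, sin r ^ (m + 1) * latitudeMean (m + 2) θ r
  set K := ∫ r in (0 : ℝ)..a, sin r ^ (m + 1) * greenProfile (m + 2) ((1 - cos r) / 2)
  have hle : A ≤ I * greenProfile (m + 2) ((1 + cos θ) / 2) + K := by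
    rw [← hsum]
    refine intervalIntegral.integral_mono_on ha.1.le (hcont.intervalIntegrable_of_Icc ha.1.le)
      ((hsinI.mul_const _).add (hcontK.intervalIntegrable_of_Icc ha.1.le)) fun r hr => ?_
    rw [← mul_add]
    exact mul_le_mul_of_nonneg_left (latitudeMean_le hn0 hθ hr.1 (hr.2.trans_lt ha.2))
      (pow_nonneg (sin_nonneg_of_nonneg_of_le_pi hr.1 (hr.2.trans ha.2.le)) _)
  have e1 : 1 / (sphereVol (m + 1) * I) * (C * (sphereVol (m + 1) *
      (A - greenMean (m + 2) * I))) = C * (A / I - greenMean (m + 2)) := by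
    field_simp
  have e2 : C * (greenProfile (m + 2) ((1 + cos θ) / 2) - greenMean (m + 2)) + C * (K / I) =
      C * ((I * greenProfile (m + 2) ((1 + cos θ) / 2) + K) / I - greenMean (m + 2)) := by
    field_simp
    ring
  rw [e1, e2]
  refine ⟨by gcongr, fun haθ => ?_⟩
  have heq : A = I * greenProfile (m + 2) ((1 + cos θ) / 2) + K := by
    rw [← hsum]
    refine intervalIntegral.integral_congr fun r hr => ?_
    rw [Set.uIcc_of_le ha.1.le] at hr
    simp only [latitudeMean_eq_of_le (hr.2.trans haθ), mul_add]
  rw [heq]
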